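/- arXiv:1704.08905 — 2 statements merged into one kernel-verified Lean document; each statement's English description precedes it below -/
import Mathlib

section
/- There exists a constant C > 0, depending only on K0, a, δ, and m, with the following property. Let h1, h2 ∈ X_{L,ρ} and assume 1/2 ≤ Q[h_i](y) ≤ 3/2 for all y < Lρ and i = 1,2. Then for all x < y ≤ Lρ: if x ≤ −Lρ and y ≤ −Lρ, |e^{ψ_ρ[h1](y)−ψ_ρ[h1](x)} − e^{ψ_ρ[h2](y)−ψ_ρ[h2](x)}| ≤ C·ρ·e^{(2a+2)L}·‖h1−h2‖·e^{−(a/ρ)x}·e^{(2m/ρ)(x−y)}; if x ≤ −Lρ and −Lρ ≤ y ≤ Lρ, the same left-hand side is ≤ C·ρ·e^{(2a+2)L}·‖h1−h2‖·e^{−(a/ρ)x}·e^{(2m/ρ)(x+Lρ)}; and if −Lρ < x < Lρ, it is ≤ C·ρ·e^{(3a+2)L}·‖h1−h2‖. -/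
open Set MeasureTheory Filter

/-- The weight exponent ω. -/
noncomputable def omegaFn (m L ρ x : ℝ) : ℝ :=
  if x ≤ -(L*ρ) then m/ρ*(x+L*ρ) else if x < L*ρ then 0 else -(1/2)*(x - L*ρ)

/-- The norm on the space X_{L,ρ}. -/
noncomputable def normX (m L ρ : ℝ) (h : ℝ → ℝ) : ℝ :=
  ⨆ x : ℝ, |h x| * Real.exp (-(omegaFn m L ρ x))

/-- Membership in the space X_{L,ρ}. -/
def memX (a m L ρ : ℝ) (h : ℝ → ℝ) : Prop :=
  ContinuousOn h {x : ℝ | x ≠ L*ρ} ∧ (∫ x : ℝ, h x) = 1 ∧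
  (1/ρ) * (∫ x : ℝ, Real.exp (-(a/ρ)*x) * h x) = 1/(1+ρ) ∧
  ∀ x : ℝ, |h x| ≤ 2 * Real.exp (omegaFn m L ρ x)

/-- The hypotheses on the coagulation kernel K. -/
def KernelHyp (K : ℝ → ℝ → ℝ) (γ a K0 δ : ℝ) : Prop :=
  γ < 1 ∧ a = 1 - γ ∧
  ContinuousOn (fun p : ℝ × ℝ => K p.1 p.2) (Ioi 0 ×ˢ Ioi 0) ∧
  (∀ x y : ℝ, 0 < x → 0 < y → 0 ≤ K x y) ∧
  (∀ x y : ℝ, 0 < x → 0 < y → K x y = K y x) ∧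
  (∀ x y α : ℝ, 0 < x → 0 < y → 0 < α → K (α*x) (α*y) = α ^ γ * K x y) ∧
  0 < K0 ∧ δ ∈ Ioo 0 (min 1 a) ∧
  ∀ x ∈ Ioo (0:ℝ) 2, |x ^ a * K x 1 - 1| ≤ K0 * x ^ δ

/-- The hypotheses on the fixed parameters m, L0, ρ0. -/
def ParamHyp (a m L0 ρ0 : ℝ) : Prop :=
  max (a+1) (3*a) < m ∧ (1/a) * Real.log (4*m) < L0 ∧ ρ0 ∈ Ioo (0:ℝ) 1

/-- The function Q[h]. -/
noncomputable def Qfun (K : ℝ → ℝ → ℝ) (a ρ : ℝ) (h : ℝ → ℝ) (y : ℝ) : ℝ :=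
  ∫ z : ℝ, Real.exp (a/ρ*(y-z)) * K (Real.exp ((y-z)/ρ)) 1 * h z

/-- The function ψ_ρ[h]. -/
noncomputable def psiFn (K : ℝ → ℝ → ℝ) (a L ρ : ℝ) (h : ℝ → ℝ) (x : ℝ) : ℝ :=
  (1/ρ) * ∫ y in Ioo x (L*ρ), Real.exp (-(a/ρ)*y) * Qfun K a ρ h y

/-- The remainder R[h]. -/
noncomputable def Rfun (K : ℝ → ℝ → ℝ) (a L ρ : ℝ) (h : ℝ → ℝ) (x : ℝ) : ℝ :=
  if x < L*ρ then
    -(1/ρ) * ∫ y in Iio x, ∫ z in Iio (x + ρ * Real.log (1 - Real.exp ((y-x)/ρ))),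
      Real.exp (-(a/ρ)*z) * K (Real.exp ((y-z)/ρ)) 1 * h y * h z
  else
    -(1/ρ) * (∫ y in Ioi x, Real.exp (-(a/ρ)*y) * h y) * (∫ z in Ioi x, h z)
    + (1/ρ) * (∫ y in Iio x, ∫ z in Ioi x,
        (Real.exp (-(a/ρ)*z) * K (Real.exp ((y-z)/ρ)) 1 - Real.exp (-(a/ρ)*y)) * h y * h z)
    + (1/ρ) * (∫ y in Iio x, ∫ z in Ioo (x + ρ * Real.log (1 - Real.exp ((y-x)/ρ))) x,
        Real.exp (-(a/ρ)*z) * K (Real.exp ((y-z)/ρ)) 1 * h y * h z)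

/-- The remainder R̃[h]. -/
noncomputable def Rtil (K : ℝ → ℝ → ℝ) (a L ρ : ℝ) (h : ℝ → ℝ) (x : ℝ) : ℝ :=
  if x < L*ρ then
    Rfun K a L ρ h x - (1/ρ) * ∫ y in Ioo x (L*ρ),
      Real.exp (-(psiFn K a L ρ h x - psiFn K a L ρ h y)) * Real.exp (-(a/ρ)*y) *
        Qfun K a ρ h y * Rfun K a L ρ h y
  else
    Rfun K a L ρ h x - (1/(1+ρ)) * ∫ y in Ioo (L*ρ) x,
      Real.exp ((y-x)/(1+ρ)) * Rfun K a L ρ h y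

/-- Equation (E) in exponential variables. -/
def solvesE (K : ℝ → ℝ → ℝ) (a ρ : ℝ) (h : ℝ → ℝ) : Prop :=
  ∀ x : ℝ, h x = (1/ρ) * ∫ y in Iio x,
    ∫ z in Ioi (x + ρ * Real.log (1 - Real.exp ((y-x)/ρ))),
      Real.exp (-(a/ρ)*z) * K (Real.exp ((y-z)/ρ)) 1 * h y * h z

/-- The decay exponent λ. -/
noncomputable def lamFn (K : ℝ → ℝ → ℝ) (a L ρ : ℝ) (h : ℝ → ℝ) (x : ℝ) : ℝ :=
  if x < L*ρ then -psiFn K a L ρ h x else -(1/2)*(x - L*ρ)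

/-- The remainder H. -/
noncomputable def Hfun (K : ℝ → ℝ → ℝ) (a ρ : ℝ) (h : ℝ → ℝ) (x : ℝ) : ℝ :=
  (1/ρ) * (∫ y in Iio x, ∫ z in Ioi (x + ρ * Real.log (1 - Real.exp ((y-x)/ρ))),
      Real.exp (-(a/ρ)*z) * K (Real.exp ((y-z)/ρ)) 1 * h y * h z)
    - (ρ/(1+ρ)) * h x - (1/(1+ρ)) * ∫ z in Ioi x, h z

lemma aux_laplace {c : ℝ} (hc : 0 < c) (b : ℝ) :
    Integrable (fun z : ℝ => Real.exp (-c * |z - b|)) ∧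
      ∫ z : ℝ, Real.exp (-c * |z - b|) = 2 / c := by
  have h1 : ∫ z : ℝ, Real.exp (-c * |z - b|) = 2 / c := by
    rw [integral_sub_right_eq_self (fun z : ℝ => Real.exp (-c * |z|)) b]
    rw [integral_comp_abs (f := fun z => Real.exp (-c * z)),
      integral_exp_mul_Ioi (by linarith) 0]
    simp
    field_simp
  refine ⟨Integrable.of_integral_ne_zero ?_, h1⟩
  rw [h1]; positivity

lemma aux_kernel {K : ℝ → ℝ → ℝ} {γ a K0 δ : ℝ} (hK : KernelHyp K γ a K0 δ) (s : ℝ) :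
    (s ≤ 0 → |Real.exp (a*s) * K (Real.exp s) 1 - 1| ≤ K0 * Real.exp (δ*s)) ∧
    (0 ≤ s → |Real.exp (a*s) * K (Real.exp s) 1 - 1| ≤ (2+K0) * Real.exp ((1+a)*s)) := by
  obtain ⟨hγ, ha, -, -, hsym, hhom, hK0, hδ, hb⟩ := hK
  have hδ0 : 0 < δ := hδ.1
  have ha0 : 0 < a := by linarith
  have key : ∀ s : ℝ, s ≤ 0 →
      |Real.exp (a*s) * K (Real.exp s) 1 - 1| ≤ K0 * Real.exp (δ*s) := by
    intro s hs
    have h1 : Real.exp s ≤ 1 := Real.exp_le_one_iff.2 hs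
    have := hb (Real.exp s) ⟨Real.exp_pos s, by linarith⟩
    rw [← Real.exp_mul, ← Real.exp_mul, mul_comm s a, mul_comm s δ] at this
    exact this
  refine ⟨key s, fun hs => ?_⟩
  have h2 := key (-s) (by linarith)
  have e1 : K (Real.exp s) 1 = Real.exp (γ*s) * K (Real.exp (-s)) 1 := by
    have := hhom 1 (Real.exp (-s)) (Real.exp s) one_pos (Real.exp_pos _) (Real.exp_pos _)
    rw [mul_one, ← Real.exp_add, add_neg_cancel, Real.exp_zero, ← Real.exp_mul,
      hsym 1 _ one_pos (Real.exp_pos _), mul_comm s γ] at this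
    exact this
  have e2 : Real.exp (a*s) * K (Real.exp s) 1
      = Real.exp ((1+a)*s) * (Real.exp (a*(-s)) * K (Real.exp (-s)) 1) := by
    rw [e1, ← mul_assoc, ← mul_assoc, ← Real.exp_add, ← Real.exp_add]
    congr 2
    rw [ha]; ring
  rw [e2]
  set v := Real.exp (a*(-s)) * K (Real.exp (-s)) 1
  have h3 : Real.exp (δ * (-s)) ≤ 1 := Real.exp_le_one_iff.2 (by nlinarith)
  have h4 : 1 ≤ Real.exp ((1+a)*s) := Real.one_le_exp (by positivity)
  have h5 : |v - 1| ≤ K0 := by nlinarith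
  rw [abs_le] at h5 ⊢
  constructor <;> nlinarith

lemma aux_norm {a m L ρ : ℝ} {h1 h2 : ℝ → ℝ} (m1 : memX a m L ρ h1) (m2 : memX a m L ρ h2)
    (z : ℝ) : |h1 z - h2 z| ≤ normX m L ρ (fun t => h1 t - h2 t) * Real.exp (omegaFn m L ρ z) := by
  have hb : BddAbove (range fun x => |h1 x - h2 x| * Real.exp (-(omegaFn m L ρ x))) := by
    refine ⟨4, ?_⟩
    rintro _ ⟨x, rfl⟩
    have b1 := m1.2.2.2 x
    have b2 := m2.2.2.2 x
    have b3 := abs_sub (h1 x) (h2 x)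
    have : |h1 x - h2 x| ≤ 4 * Real.exp (omegaFn m L ρ x) := by linarith
    calc _ ≤ 4 * Real.exp (omegaFn m L ρ x) * Real.exp (-(omegaFn m L ρ x)) :=
          mul_le_mul_of_nonneg_right this (Real.exp_pos _).le
      _ = 4 := by rw [mul_assoc, ← Real.exp_add]; simp
  have h := le_ciSup hb z
  have : |h1 z - h2 z| * Real.exp (-(omegaFn m L ρ z)) * Real.exp (omegaFn m L ρ z)
      ≤ normX m L ρ (fun t => h1 t - h2 t) * Real.exp (omegaFn m L ρ z) :=
    mul_le_mul_of_nonneg_right h (Real.exp_pos _).le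
  rw [mul_assoc, ← Real.exp_add] at this
  simpa using this

lemma aux_norm_nonneg {m L ρ : ℝ} {h : ℝ → ℝ} : 0 ≤ normX m L ρ h :=
  Real.iSup_nonneg fun _ => by positivity

lemma aux_Qmeas {K : ℝ → ℝ → ℝ} {γ a K0 δ m L ρ : ℝ} (hK : KernelHyp K γ a K0 δ)
    {h : ℝ → ℝ} (hm : memX a m L ρ h) : Measurable (Qfun K a ρ h) := by
  have hh : Measurable h := measurable_of_continuousOn_compl_singleton (L*ρ) hm.1
  have hk : Continuous (fun s : ℝ => K (Real.exp s) 1) := by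
    have := hK.2.2.1.comp_continuous (f := fun s : ℝ => (Real.exp s, (1:ℝ))) (by fun_prop)
      (fun s => ⟨Real.exp_pos s, mem_Ioi.2 one_pos⟩)
    exact this
  unfold Qfun
  refine (StronglyMeasurable.integral_prod_right (ν := volume) (f := fun y z : ℝ =>
    Real.exp (a/ρ*(y-z)) * K (Real.exp ((y-z)/ρ)) 1 * h z) ?_).measurable
  apply Measurable.stronglyMeasurable
  have h1 : Measurable (fun p : ℝ × ℝ => K (Real.exp ((p.1-p.2)/ρ)) 1) :=
    hk.measurable.comp (g := fun s : ℝ => K (Real.exp s) 1) (by fun_prop)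
  have h2 : Measurable (fun p : ℝ × ℝ => h p.2) := hh.comp measurable_snd
  have h3 : Measurable (fun p : ℝ × ℝ => Real.exp (a/ρ*(p.1-p.2))) := by fun_prop
  exact (h3.mul h1).mul h2

lemma aux_D {K : ℝ → ℝ → ℝ} {γ a K0 δ m L ρ ε : ℝ} (hK : KernelHyp K γ a K0 δ)
    (hε : 0 < ε) (hε1 : ε ≤ m - 1 - a) (hε2 : ε ≤ 1 + a) (hL : 0 < L) (hρ : 0 < ρ)
    {h1 h2 : ℝ → ℝ} (m1 : memX a m L ρ h1) (m2 : memX a m L ρ h2) (y : ℝ) (hy : y < L*ρ)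
    (q1 : Qfun K a ρ h1 y ∈ Icc (1/2:ℝ) (3/2)) (q2 : Qfun K a ρ h2 y ∈ Icc (1/2:ℝ) (3/2)) :
    |Qfun K a ρ h1 y - Qfun K a ρ h2 y| ≤ (2*(2+K0)/ε + 2*K0/δ) *
      (ρ * Real.exp ((2*a+2)*L) * normX m L ρ (fun t => h1 t - h2 t)) := by
  have hker := aux_kernel hK
  have ha0 : 0 < a := by have := hK.1; have := hK.2.1; linarith
  obtain ⟨-, -, -, -, -, -, hK0, hδ, -⟩ := hK
  have hδ0 : 0 < δ := hδ.1
  set N := normX m L ρ (fun t => h1 t - h2 t) with hN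
  have hN0 : 0 ≤ N := aux_norm_nonneg
  have i1 : Integrable h1 := Integrable.of_integral_ne_zero (by rw [m1.2.1]; simp)
  have i2 : Integrable h2 := Integrable.of_integral_ne_zero (by rw [m2.2.1]; simp)
  have j1 : Integrable (fun z => Real.exp (a/ρ*(y-z)) * K (Real.exp ((y-z)/ρ)) 1 * h1 z) :=
    Integrable.of_integral_ne_zero (by
      have := q1.1; unfold Qfun at this; intro h; rw [h] at this; norm_num at this)
  have j2 : Integrable (fun z => Real.exp (a/ρ*(y-z)) * K (Real.exp ((y-z)/ρ)) 1 * h2 z) :=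
    Integrable.of_integral_ne_zero (by
      have := q2.1; unfold Qfun at this; intro h; rw [h] at this; norm_num at this)
  have eq : Qfun K a ρ h1 y - Qfun K a ρ h2 y = ∫ z : ℝ,
      ((Real.exp (a/ρ*(y-z)) * K (Real.exp ((y-z)/ρ)) 1 * h1 z
        - Real.exp (a/ρ*(y-z)) * K (Real.exp ((y-z)/ρ)) 1 * h2 z) - (h1 z - h2 z)) := by
    have hj := j1.sub j2
    have hi := i1.sub i2
    simp only [Pi.sub_def] at hj hi
    rw [integral_sub hj hi, integral_sub j1 j2, integral_sub i1 i2,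
      m1.2.1, m2.2.1]
    simp [Qfun]
  obtain ⟨l1, l1'⟩ := aux_laplace (c := ε/ρ) (by positivity) (-(L*ρ))
  obtain ⟨l2, l2'⟩ := aux_laplace (c := δ/ρ) (by positivity) y
  set c := Real.exp ((2*a+2)*L) with hc
  have hc1 : 1 ≤ c := Real.one_le_exp (by positivity)
  have main : |Qfun K a ρ h1 y - Qfun K a ρ h2 y| ≤ ∫ z : ℝ,
      (N * (2+K0) * c * Real.exp (-(ε/ρ) * |z - -(L*ρ)|)
        + N * K0 * Real.exp (-(δ/ρ) * |z - y|)) := by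
    rw [eq, ← Real.norm_eq_abs]
    refine norm_integral_le_of_norm_le ((l1.const_mul _).add (l2.const_mul _))
      (Eventually.of_forall fun z => ?_)
    have e : (Real.exp (a/ρ*(y-z)) * K (Real.exp ((y-z)/ρ)) 1 * h1 z
        - Real.exp (a/ρ*(y-z)) * K (Real.exp ((y-z)/ρ)) 1 * h2 z) - (h1 z - h2 z)
        = (Real.exp (a*((y-z)/ρ)) * K (Real.exp ((y-z)/ρ)) 1 - 1) * (h1 z - h2 z) := by
      rw [show a/ρ*(y-z) = a*((y-z)/ρ) by ring]; ring
    rw [e, Real.norm_eq_abs, abs_mul]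
    have hz := aux_norm m1 m2 z
    rw [← hN] at hz
    have P1 : 0 ≤ N * (2+K0) * c * Real.exp (-(ε/ρ) * |z - -(L*ρ)|) := by positivity
    have P2 : 0 ≤ N * K0 * Real.exp (-(δ/ρ) * |z - y|) := by positivity
    rcases le_total y z with hyz | hyz
    · have k1 := (hker ((y-z)/ρ)).1 (div_nonpos_of_nonpos_of_nonneg (by linarith) hρ.le)
      have ω0 : omegaFn m L ρ z ≤ 0 := by
        unfold omegaFn
        split_ifs with h1 h2
        · exact mul_nonpos_of_nonneg_of_nonpos (div_nonneg (by linarith) hρ.le) (by linarith)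
        · exact le_rfl
        · linarith
      have w : Real.exp (omegaFn m L ρ z) ≤ 1 := Real.exp_le_one_iff.2 ω0
      have hz' : |h1 z - h2 z| ≤ N := by nlinarith
      have : |Real.exp (a*((y-z)/ρ)) * K (Real.exp ((y-z)/ρ)) 1 - 1| * |h1 z - h2 z|
          ≤ K0 * Real.exp (δ * ((y-z)/ρ)) * N := by gcongr
      have e3 : δ * ((y-z)/ρ) = -(δ/ρ) * |z - y| := by
        rw [abs_of_nonneg (by linarith)]; ring
      rw [e3] at this
      linarith
    · have k1 := (hker ((y-z)/ρ)).2 (div_nonneg (by linarith) hρ.le)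
      have ex : (1+a)*((y-z)/ρ) + omegaFn m L ρ z ≤ (2*a+2)*L + -(ε/ρ) * |z - -(L*ρ)| := by
        have hyL : (y + L*ρ)/ρ ≤ 2*L := by rw [div_le_iff₀ hρ]; linarith
        have t1 : (1+a)*((y + L*ρ)/ρ) ≤ (1+a)*(2*L) := by gcongr
        have sp : (y-z)/ρ = (y + L*ρ)/ρ - (z+L*ρ)/ρ := by ring
        unfold omegaFn
        split_ifs with g1 g2
        · rw [abs_of_nonpos (by linarith), sp]
          have u : (z+L*ρ)/ρ ≤ 0 := div_nonpos_of_nonpos_of_nonneg (by linarith) hρ.le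
          have e4 : m/ρ*(z+L*ρ) = m*((z+L*ρ)/ρ) := by ring
          have e5 : -(ε/ρ) * -(z - -(L*ρ)) = ε*((z+L*ρ)/ρ) := by ring
          rw [e4, e5]
          nlinarith
        · rw [abs_of_nonneg (by linarith), sp]
          have u : 0 ≤ (z+L*ρ)/ρ := div_nonneg (by linarith) hρ.le
          have e5 : -(ε/ρ) * (z - -(L*ρ)) = -(ε*((z+L*ρ)/ρ)) := by ring
          rw [e5]
          nlinarith
        · linarith
      have : |Real.exp (a*((y-z)/ρ)) * K (Real.exp ((y-z)/ρ)) 1 - 1| * |h1 z - h2 z|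
          ≤ ((2+K0) * Real.exp ((1+a)*((y-z)/ρ))) * (N * Real.exp (omegaFn m L ρ z)) := by
        gcongr
      have e6 : ((2+K0) * Real.exp ((1+a)*((y-z)/ρ))) * (N * Real.exp (omegaFn m L ρ z))
          = N * (2+K0) * Real.exp ((1+a)*((y-z)/ρ) + omegaFn m L ρ z) := by
        rw [Real.exp_add]; ring
      have e7 : N * (2+K0) * Real.exp ((1+a)*((y-z)/ρ) + omegaFn m L ρ z)
          ≤ N * (2+K0) * Real.exp ((2*a+2)*L + -(ε/ρ) * |z - -(L*ρ)|) := by gcongr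
      rw [Real.exp_add ((2*a+2)*L), ← mul_assoc] at e7
      linarith
  rw [integral_add (l1.const_mul _) (l2.const_mul _), integral_const_mul, integral_const_mul,
    l1', l2'] at main
  refine main.trans ?_
  have e8 : N * (2+K0) * c * (2/(ε/ρ)) + N * K0 * (2/(δ/ρ))
    = 2*(2+K0)/ε * (ρ * c * N) + 2*K0/δ * (ρ * 1 * N) := by field_simp
  rw [e8, add_mul]
  gcongr

lemma aux_exp {A B E M : ℝ} (hA : E/2 ≤ A) (hB : E/2 ≤ B) (hM : |A - B| ≤ M) :
    |Real.exp (-A) - Real.exp (-B)| ≤ M * Real.exp (-(E/2)) := by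
  have key : ∀ A B : ℝ, E/2 ≤ A → A ≤ B → |A - B| ≤ M →
      |Real.exp (-A) - Real.exp (-B)| ≤ M * Real.exp (-(E/2)) := by
    intro A B hA hAB hM
    have h1 : Real.exp (-B) ≤ Real.exp (-A) := Real.exp_le_exp.2 (by linarith)
    rw [abs_of_nonneg (by linarith)]
    have h2 : Real.exp (-A) ≤ Real.exp (-(E/2)) := Real.exp_le_exp.2 (by linarith)
    have h3 : Real.exp (-B) = Real.exp (-A) * Real.exp (A - B) := by
      rw [← Real.exp_add]; congr 1; ring
    have h4 := Real.add_one_le_exp (A - B)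
    rw [abs_of_nonpos (by linarith)] at hM
    have h5 := Real.exp_pos (-A)
    calc Real.exp (-A) - Real.exp (-B) = (1 - Real.exp (A-B)) * Real.exp (-A) := by rw [h3]; ring
      _ ≤ M * Real.exp (-A) := by gcongr; linarith
      _ ≤ M * Real.exp (-(E/2)) := by gcongr; linarith
  rcases le_total A B with h | h
  · exact key A B hA h hM
  · rw [abs_sub_comm]; rw [abs_sub_comm] at hM; exact key B A hB h hM

lemma aux_int {c : ℝ} (hc : c ≠ 0) (x y : ℝ) :
    ∫ t in x..y, Real.exp (-c*t) = (Real.exp (-c*x) - Real.exp (-c*y))/c := by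
  have : ∀ t ∈ uIcc x y, HasDerivAt (fun t => -Real.exp (-c*t)/c) (Real.exp (-c*t)) t := by
    intro t _
    have := ((((hasDerivAt_id t).const_mul (-c)).exp).neg).div_const c
    refine this.congr_deriv ?_
    simp; field_simp
  rw [intervalIntegral.integral_eq_sub_of_hasDerivAt this
    (Continuous.intervalIntegrable (by fun_prop) _ _)]
  ring

lemma aux_psi {K : ℝ → ℝ → ℝ} {a L ρ : ℝ} {h : ℝ → ℝ} (hQ : Measurable (Qfun K a ρ h))
    (q : ∀ y : ℝ, y < L*ρ → Qfun K a ρ h y ∈ Icc (1/2:ℝ) (3/2)) (x y : ℝ) (hxy : x < y)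
    (hy : y ≤ L*ρ) :
    IntervalIntegrable (fun t => Real.exp (-(a/ρ)*t) * Qfun K a ρ h t) volume x y ∧
    psiFn K a L ρ h y - psiFn K a L ρ h x
      = -((1/ρ) * ∫ t in x..y, Real.exp (-(a/ρ)*t) * Qfun K a ρ h t) := by
  have I : ∀ u v : ℝ, u ≤ v → v ≤ L*ρ →
      IntervalIntegrable (fun t => Real.exp (-(a/ρ)*t) * Qfun K a ρ h t) volume u v := by
    intro u v huv hv
    rw [intervalIntegrable_iff_integrableOn_Ioo_of_le huv]
    have J : IntegrableOn (fun t => (3/2) * Real.exp (-(a/ρ)*t)) (Ioo u v) :=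
      (Continuous.integrableOn_Icc (by fun_prop)).mono_set Ioo_subset_Icc_self
    refine Integrable.mono' J (by fun_prop) ?_
    refine (ae_restrict_iff' measurableSet_Ioo).2 (Eventually.of_forall fun t ht => ?_)
    have := q t (by linarith [ht.2])
    rw [Real.norm_eq_abs, abs_mul, abs_of_pos (Real.exp_pos _), abs_of_nonneg (by linarith [this.1]),
      mul_comm]
    gcongr
    exact this.2
  refine ⟨I x y hxy.le hy, ?_⟩
  unfold psiFn
  rw [← integral_Ioc_eq_integral_Ioo, ← integral_Ioc_eq_integral_Ioo,
    ← intervalIntegral.integral_of_le hy, ← intervalIntegral.integral_of_le (hxy.le.trans hy),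
    ← intervalIntegral.integral_add_adjacent_intervals (I x y hxy.le hy) (I y _ hy le_rfl)]
  ring

lemma aux_core {K : ℝ → ℝ → ℝ} {a L ρ B : ℝ} {h1 h2 : ℝ → ℝ} (ha : 0 < a) (hρ : 0 < ρ)
    (hQ1 : Measurable (Qfun K a ρ h1)) (hQ2 : Measurable (Qfun K a ρ h2))
    (q1 : ∀ y : ℝ, y < L*ρ → Qfun K a ρ h1 y ∈ Icc (1/2:ℝ) (3/2))
    (q2 : ∀ y : ℝ, y < L*ρ → Qfun K a ρ h2 y ∈ Icc (1/2:ℝ) (3/2))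
    (hD : ∀ y : ℝ, y < L*ρ → |Qfun K a ρ h1 y - Qfun K a ρ h2 y| ≤ B)
    (x y : ℝ) (hxy : x < y) (hy : y ≤ L*ρ) :
    |Real.exp (psiFn K a L ρ h1 y - psiFn K a L ρ h1 x)
      - Real.exp (psiFn K a L ρ h2 y - psiFn K a L ρ h2 x)|
    ≤ B * ((Real.exp (-(a/ρ)*x) - Real.exp (-(a/ρ)*y))/a)
      * Real.exp (-(((Real.exp (-(a/ρ)*x) - Real.exp (-(a/ρ)*y))/a)/2)) := by
  obtain ⟨I1, e1⟩ := aux_psi hQ1 q1 x y hxy hy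
  obtain ⟨I2, e2⟩ := aux_psi hQ2 q2 x y hxy hy
  rw [e1, e2]
  set E := (Real.exp (-(a/ρ)*x) - Real.exp (-(a/ρ)*y))/a with hE
  have hint : ∫ t in x..y, Real.exp (-(a/ρ)*t) = ρ * E := by
    rw [aux_int (by positivity), hE]; field_simp
  have I0 : IntervalIntegrable (fun t => Real.exp (-(a/ρ)*t)) volume x y :=
    Continuous.intervalIntegrable (by fun_prop) _ _
  have low : ∀ h : ℝ → ℝ, (∀ y : ℝ, y < L*ρ → Qfun K a ρ h y ∈ Icc (1/2:ℝ) (3/2)) →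
      IntervalIntegrable (fun t => Real.exp (-(a/ρ)*t) * Qfun K a ρ h t) volume x y →
      E/2 ≤ (1/ρ) * ∫ t in x..y, Real.exp (-(a/ρ)*t) * Qfun K a ρ h t := by
    intro h q I
    have := intervalIntegral.integral_mono_on_of_le_Ioo hxy.le (I0.const_mul (1/2)) I
      (fun t ht => by
        have := (q t (by linarith [ht.2])).1
        have := Real.exp_pos (-(a/ρ)*t)
        nlinarith)
    rw [intervalIntegral.integral_const_mul, hint] at this
    calc E/2 = (1/ρ) * (1/2*(ρ*E)) := by field_simp
      _ ≤ _ := by gcongr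
  refine aux_exp (low h1 q1 I1) (low h2 q2 I2) ?_
  rw [← mul_sub, ← intervalIntegral.integral_sub I1 I2, abs_mul, abs_of_pos (by positivity : 0 < 1/ρ)]
  have hne : ∀ᵐ t : ℝ, t ≠ y := by simp [ae_iff]
  have := intervalIntegral.norm_integral_le_of_norm_le (μ := volume) hxy.le
    (f := fun t => Real.exp (-(a/ρ)*t) * Qfun K a ρ h1 t - Real.exp (-(a/ρ)*t) * Qfun K a ρ h2 t)
    (g := fun t => B * Real.exp (-(a/ρ)*t))
    (by
      filter_upwards [hne] with t hty ht
      have : t < y := lt_of_le_of_ne ht.2 hty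
      rw [← mul_sub, Real.norm_eq_abs, abs_mul, abs_of_pos (Real.exp_pos _), mul_comm]
      gcongr
      exact hD t (by linarith)) (I0.const_mul B)
  rw [intervalIntegral.integral_const_mul, hint, Real.norm_eq_abs] at this
  calc _ ≤ 1/ρ * (B * (ρ * E)) := by gcongr
    _ = B * E := by field_simp

lemma aux_decay {a m L ρ x y : ℝ} (ha : 0 < a) (hρ : 0 < ρ) (hL : 4*m ≤ Real.exp (a*L))
    (hxy : x ≤ y) (hy : y ≤ -(L*ρ)) :
    2*m/ρ*(y-x) ≤ ((Real.exp (-(a/ρ)*x) - Real.exp (-(a/ρ)*y))/a)/2 := by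
  have e : Real.exp (-(a/ρ)*x) = Real.exp (-(a/ρ)*y) * Real.exp (a*((y-x)/ρ)) := by
    rw [← Real.exp_add]; congr 1; ring
  have h1 : Real.exp (a*L) ≤ Real.exp (-(a/ρ)*y) := by
    apply Real.exp_le_exp.2
    have : a/ρ*(y + L*ρ) ≤ 0 := mul_nonpos_of_nonneg_of_nonpos (by positivity) (by linarith)
    have e2 : a/ρ*(y + L*ρ) = a/ρ*y + a*L := by field_simp
    linarith
  have h2 := Real.add_one_le_exp (a*((y-x)/ρ))
  have hd : 0 ≤ (y-x)/ρ := div_nonneg (by linarith) hρ.le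
  rw [div_div, le_div_iff₀ (by positivity), e]
  have h3 : Real.exp (-(a/ρ)*y) * (a*((y-x)/ρ)) ≤
      Real.exp (-(a/ρ)*y) * (Real.exp (a*((y-x)/ρ)) - 1) := by gcongr; linarith
  have h4 : 4*m * (a*((y-x)/ρ)) ≤ Real.exp (-(a/ρ)*y) * (a*((y-x)/ρ)) := by
    gcongr; linarith
  have e5 : 2*m/ρ*(y-x)*(a*2) = 4*m * (a*((y-x)/ρ)) := by ring
  linarith

/-- Lipschitz estimates for exponentials of ψ-differences
(estimate (4.7) of the paper). -/
theorem psi_difference_estimates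
    (γ a K0 δ m : ℝ) (hγ : γ < 1) (ha : a = 1 - γ)
    (hK0 : 0 < K0) (hδ : δ ∈ Ioo 0 (min 1 a)) (hm : max (a+1) (3*a) < m) :
    ∃ C : ℝ, 0 < C ∧
      ∀ K : ℝ → ℝ → ℝ, KernelHyp K γ a K0 δ →
      ∀ L0 ρ0 : ℝ, ParamHyp a m L0 ρ0 →
      ∀ L : ℝ, L0 ≤ L → ∀ ρ ∈ Ioo (0:ℝ) ρ0,
      ∀ h1 h2 : ℝ → ℝ, memX a m L ρ h1 → memX a m L ρ h2 →
      (∀ y : ℝ, y < L*ρ → Qfun K a ρ h1 y ∈ Icc (1/2:ℝ) (3/2)) →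
      (∀ y : ℝ, y < L*ρ → Qfun K a ρ h2 y ∈ Icc (1/2:ℝ) (3/2)) →
      ∀ x y : ℝ, x < y → y ≤ L*ρ →
        (x ≤ -(L*ρ) → y ≤ -(L*ρ) →
          |Real.exp (psiFn K a L ρ h1 y - psiFn K a L ρ h1 x)
              - Real.exp (psiFn K a L ρ h2 y - psiFn K a L ρ h2 x)|
            ≤ C * ρ * Real.exp ((2*a+2)*L) * normX m L ρ (fun t => h1 t - h2 t)
              * Real.exp (-(a/ρ)*x) * Real.exp ((2*m/ρ)*(x-y))) ∧
        (x ≤ -(L*ρ) → -(L*ρ) ≤ y →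
          |Real.exp (psiFn K a L ρ h1 y - psiFn K a L ρ h1 x)
              - Real.exp (psiFn K a L ρ h2 y - psiFn K a L ρ h2 x)|
            ≤ C * ρ * Real.exp ((2*a+2)*L) * normX m L ρ (fun t => h1 t - h2 t)
              * Real.exp (-(a/ρ)*x) * Real.exp ((2*m/ρ)*(x+L*ρ))) ∧
        (-(L*ρ) < x →
          |Real.exp (psiFn K a L ρ h1 y - psiFn K a L ρ h1 x)
              - Real.exp (psiFn K a L ρ h2 y - psiFn K a L ρ h2 x)|
            ≤ C * ρ * Real.exp ((3*a+2)*L) * normX m L ρ (fun t => h1 t - h2 t)) := by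
  have ha0 : 0 < a := by linarith
  have hm1 : a + 1 < m := lt_of_le_of_lt (le_max_left _ _) hm
  have hδ0 : 0 < δ := hδ.1
  obtain ⟨ε, hε, hε1, hε2⟩ : ∃ ε : ℝ, 0 < ε ∧ ε ≤ m - 1 - a ∧ ε ≤ 1 + a :=
    ⟨min (m-1-a) (1+a), lt_min (by linarith) (by linarith), min_le_left _ _, min_le_right _ _⟩
  set C1 := 2*(2+K0)/ε + 2*K0/δ with hC1
  have hC1p : 0 < C1 := by positivity
  refine ⟨C1/a, by positivity, ?_⟩
  intro K hK L0 ρ0 hP L hLL ρ hρ' h1 h2 m1 m2 q1 q2 x y hxy hy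
  have hρ : 0 < ρ := hρ'.1
  have hlog : Real.log (4*m) < a*L := by
    have := hP.2.1
    rw [one_div, inv_mul_lt_iff₀ ha0] at this
    have : a*L0 ≤ a*L := by gcongr
    linarith
  have hL : 0 < L := by
    have : 0 < Real.log (4*m) := Real.log_pos (by linarith)
    by_contra hneg
    nlinarith
  have h4m : 4*m ≤ Real.exp (a*L) := by
    rw [← Real.log_le_iff_le_exp (by linarith)]; exact hlog.le
  set N := normX m L ρ (fun t => h1 t - h2 t) with hN
  have hN0 : 0 ≤ N := aux_norm_nonneg
  have core := aux_core ha0 hρ (aux_Qmeas hK m1) (aux_Qmeas hK m2) q1 q2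
    (fun t ht => aux_D hK hε hε1 hε2 hL hρ m1 m2 t ht (q1 t ht) (q2 t ht)) x y hxy hy
  rw [← hC1, ← hN] at core
  set T := |Real.exp (psiFn K a L ρ h1 y - psiFn K a L ρ h1 x)
              - Real.exp (psiFn K a L ρ h2 y - psiFn K a L ρ h2 x)|
  set c := Real.exp ((2*a+2)*L) with hc
  have hcp : 0 < c := Real.exp_pos _
  set X := Real.exp (-(a/ρ)*x) with hX
  set Y := Real.exp (-(a/ρ)*y) with hY
  have hYp : 0 < Y := Real.exp_pos _
  have hYX : Y ≤ X := Real.exp_le_exp.2 (by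
    have : a/ρ*x ≤ a/ρ*y := by gcongr
    linarith)
  have hXE : (X - Y)/a ≤ X/a := by gcongr; linarith
  have gen : ∀ w : ℝ, -((X-Y)/a/2) ≤ w → T ≤ C1/a * ρ * c * N * X * Real.exp w := by
    intro w hw
    calc T ≤ _ := core
      _ ≤ C1 * (ρ * c * N) * (X/a) * Real.exp w := by gcongr
      _ = _ := by ring
  refine ⟨fun hx hy' => gen _ ?_, fun hx hy' => gen _ ?_, fun hx => ?_⟩
  · have := aux_decay ha0 hρ h4m hxy.le hy'
    have e : 2*m/ρ*(x-y) = -(2*m/ρ*(y-x)) := by ring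
    rw [e]; linarith
  · have := aux_decay ha0 hρ h4m hx le_rfl
    have h5 : Y ≤ Real.exp (-(a/ρ)*(-(L*ρ))) := Real.exp_le_exp.2 (by
      have : a/ρ*(-(L*ρ)) ≤ a/ρ*y := by gcongr
      linarith)
    have h6 : (X - Real.exp (-(a/ρ)*(-(L*ρ))))/a ≤ (X-Y)/a := by gcongr
    have e : 2*m/ρ*(x+L*ρ) = -(2*m/ρ*(-(L*ρ)-x)) := by ring
    rw [e]; linarith
  · have h7 := gen 0 (by
      have : 0 ≤ (X-Y)/a := div_nonneg (by linarith) ha0.le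
      linarith)
    have h8 : X ≤ Real.exp (a*L) := Real.exp_le_exp.2 (by
      have : a/ρ*(-(L*ρ)) ≤ a/ρ*x := by gcongr
      have e : a/ρ*(-(L*ρ)) = -(a*L) := by field_simp
      linarith)
    have e9 : Real.exp ((3*a+2)*L) = c * Real.exp (a*L) := by
      rw [hc, ← Real.exp_add]; congr 1; ring
    rw [e9]
    rw [Real.exp_zero, mul_one] at h7
    calc T ≤ _ := h7
      _ ≤ C1/a * ρ * c * N * Real.exp (a*L) := by gcongr
      _ = _ := by ring
end

section
/- There exists a constant C > 0, depending only on K0, a, δ, m, L0, ρ0, such that for every L ≥ L0, every ρ ∈ (0,ρ0), and every h ∈ X_{L,ρ}: |R[h](x)| ≤ C·ρ·e^{−(a/ρ)x}·e^{(2m/ρ)(x+Lρ)} for x ≤ −Lρ; |R[h](x)| ≤ C·ρ·e^{(a+2)L} for −Lρ < x < Lρ; and |R[h](x)| ≤ C·(e^{−aL} + ρ·e^{aL})·e^{−(1/2)(x−Lρ)} for x ≥ Lρ. -/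
open Set MeasureTheory Filter

lemma aux_expL (k b x : ℝ) (hk : 0 < k) :
    ∫⁻ y in Iio x, ENNReal.ofReal (Real.exp (k*y+b)) = ENNReal.ofReal (Real.exp (k*x+b)/k) := by
  have e : ∀ y, Real.exp (k*y+b) = Real.exp b * Real.exp (k*y) := fun y => by
    rw [add_comm, Real.exp_add]
  have hi := integrableOn_exp_mul_Iic hk x
  rw [setLIntegral_congr Iio_ae_eq_Iic]
  simp_rw [e]
  rw [← ofReal_integral_eq_lintegral_ofReal (hi.const_mul _)
    (Eventually.of_forall fun y => by positivity), integral_const_mul, integral_exp_mul_Iic hk]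
  congr 1; ring

lemma aux_expR (k b x : ℝ) (hk : 0 < k) :
    ∫⁻ y in Ioi x, ENNReal.ofReal (Real.exp (-k*y+b)) = ENNReal.ofReal (Real.exp (-k*x+b)/k) := by
  have e : ∀ y, Real.exp (-k*y+b) = Real.exp b * Real.exp (-k*y) := fun y => by
    rw [add_comm, Real.exp_add]
  have hi := integrableOn_exp_mul_Ioi (neg_lt_zero.2 hk) x
  simp_rw [e]
  rw [← ofReal_integral_eq_lintegral_ofReal (hi.const_mul _)
    (Eventually.of_forall fun y => by positivity), integral_const_mul,
    integral_exp_mul_Ioi (neg_lt_zero.2 hk)]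
  congr 1; field_simp

lemma aux_abs_le (I c : ℝ) (hc : 0 ≤ c) (h : ‖I‖ₑ ≤ ENNReal.ofReal c) : |I| ≤ c := by
  rw [← ofReal_norm, ENNReal.ofReal_le_ofReal_iff hc] at h
  exact h

lemma aux_dblE {A : Set ℝ} {B : ℝ → Set ℝ} (hA : MeasurableSet A) (hB : ∀ y, MeasurableSet (B y))
    (F : ℝ → ℝ → ℝ) (g : ℝ → ℝ → ENNReal) (h : ∀ y ∈ A, ∀ z ∈ B y, ‖F y z‖ₑ ≤ g y z) :
    ‖∫ y in A, ∫ z in B y, F y z‖ₑ ≤ ∫⁻ y in A, ∫⁻ z in B y, g y z := by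
  refine (enorm_integral_le_lintegral_enorm _).trans ?_
  refine setLIntegral_mono' hA fun y hy => ?_
  refine (enorm_integral_le_lintegral_enorm _).trans ?_
  exact setLIntegral_mono' (hB y) fun z hz => h y hy z hz

lemma aux_prodL (A B : Set ℝ) (P Q : ℝ → ℝ) (hP : Measurable P) (hQ : Measurable Q)
    (hP0 : ∀ y, 0 ≤ P y) (p q : ℝ) (hp0 : 0 ≤ p)
    (hp : ∫⁻ y in A, ENNReal.ofReal (P y) ≤ ENNReal.ofReal p)
    (hq : ∫⁻ y in B, ENNReal.ofReal (Q y) ≤ ENNReal.ofReal q) :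
    ∫⁻ y in A, ∫⁻ z in B, ENNReal.ofReal (P y * Q z) ≤ ENNReal.ofReal (p*q) := by
  have : ∀ y, ∫⁻ z in B, ENNReal.ofReal (P y * Q z)
      = ENNReal.ofReal (P y) * ∫⁻ z in B, ENNReal.ofReal (Q z) := fun y => by
    rw [← lintegral_const_mul _ hQ.ennreal_ofReal]
    simp_rw [ENNReal.ofReal_mul (hP0 y)]
  simp_rw [this]
  rw [lintegral_mul_const _ hP.ennreal_ofReal, ENNReal.ofReal_mul hp0]
  exact mul_le_mul' hp hq

lemma aux_dblProd {A B' : Set ℝ} {B : ℝ → Set ℝ} (hA : MeasurableSet A)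
    (hB : ∀ y, MeasurableSet (B y)) (hBB : ∀ y ∈ A, B y ⊆ B')
    (F : ℝ → ℝ → ℝ) (P1 Q1 P2 Q2 : ℝ → ℝ) (p1 q1 p2 q2 : ℝ)
    (mP1 : Measurable P1) (mQ1 : Measurable Q1) (mP2 : Measurable P2) (mQ2 : Measurable Q2)
    (nP1 : ∀ y, 0 ≤ P1 y) (nQ1 : ∀ y, 0 ≤ Q1 y) (nP2 : ∀ y, 0 ≤ P2 y) (nQ2 : ∀ y, 0 ≤ Q2 y)
    (np1 : 0 ≤ p1) (nq1 : 0 ≤ q1) (np2 : 0 ≤ p2) (nq2 : 0 ≤ q2)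
    (hp1 : ∫⁻ y in A, ENNReal.ofReal (P1 y) ≤ ENNReal.ofReal p1)
    (hq1 : ∫⁻ y in B', ENNReal.ofReal (Q1 y) ≤ ENNReal.ofReal q1)
    (hp2 : ∫⁻ y in A, ENNReal.ofReal (P2 y) ≤ ENNReal.ofReal p2)
    (hq2 : ∫⁻ y in B', ENNReal.ofReal (Q2 y) ≤ ENNReal.ofReal q2)
    (h : ∀ y ∈ A, ∀ z ∈ B y, |F y z| ≤ P1 y * Q1 z + P2 y * Q2 z) :
    |∫ y in A, ∫ z in B y, F y z| ≤ p1*q1 + p2*q2 := by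
  apply aux_abs_le _ _ (by positivity)
  refine (aux_dblE hA hB F (fun y z => ENNReal.ofReal (P1 y * Q1 z) + ENNReal.ofReal (P2 y * Q2 z))
    fun y hy z hz => ?_).trans ?_
  · rw [← ENNReal.ofReal_add (mul_nonneg (nP1 y) (nQ1 z)) (mul_nonneg (nP2 y) (nQ2 z)),
      ← ofReal_norm]
    exact ENNReal.ofReal_le_ofReal (h y hy z hz)
  calc _ ≤ ∫⁻ y in A, ∫⁻ z in B', (ENNReal.ofReal (P1 y * Q1 z) + ENNReal.ofReal (P2 y * Q2 z)) :=
        setLIntegral_mono' hA fun y hy => lintegral_mono_set (hBB y hy)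
    _ = (∫⁻ y in A, ∫⁻ z in B', ENNReal.ofReal (P1 y * Q1 z))
        + ∫⁻ y in A, ∫⁻ z in B', ENNReal.ofReal (P2 y * Q2 z) := by
        rw [← lintegral_add_left]
        · refine lintegral_congr fun y => ?_
          rw [lintegral_add_left]
          exact (mQ1.const_mul _).ennreal_ofReal
        · exact Measurable.lintegral_prod_right' (f := fun p : ℝ × ℝ => ENNReal.ofReal (P1 p.1 * Q1 p.2))
            (by fun_prop)
    _ ≤ _ := by
        rw [ENNReal.ofReal_add (by positivity) (by positivity)]
        exact add_le_add (aux_prodL _ _ _ _ mP1 mQ1 nP1 _ _ np1 hp1 hq1)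
          (aux_prodL _ _ _ _ mP2 mQ2 nP2 _ _ np2 hp2 hq2)

lemma aux_om_meas (m L ρ : ℝ) : Measurable (omegaFn m L ρ) := by
  unfold omegaFn
  refine Measurable.ite measurableSet_Iic (by fun_prop) ?_
  exact Measurable.ite measurableSet_Iio (by fun_prop) (by fun_prop)

lemma aux_om_nonpos (m L ρ : ℝ) (hm : 0 < m) (hρ : 0 < ρ) (x : ℝ) :
    omegaFn m L ρ x ≤ 0 := by
  unfold omegaFn
  split_ifs with h1 h2
  · exact mul_nonpos_of_nonneg_of_nonpos (by positivity) (by linarith)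
  · exact le_rfl
  · linarith

lemma aux_om_le (m L ρ : ℝ) (hm : 0 < m) (hρ : 0 < ρ) (hL : 0 < L) (x : ℝ) :
    omegaFn m L ρ x ≤ -(1/2)*(x - L*ρ) := by
  have hLρ : 0 < L*ρ := by positivity
  unfold omegaFn
  split_ifs with h1 h2
  · have : m/ρ*(x+L*ρ) ≤ 0 := mul_nonpos_of_nonneg_of_nonpos (by positivity) (by linarith)
    linarith
  · linarith
  · linarith

lemma aux_J (m L ρ b : ℝ) (hb : 0 < b) (hbm : b < m) (hρ : 0 < ρ) :
    ∫⁻ y, ENNReal.ofReal (Real.exp (-(b/ρ)*y + omegaFn m L ρ y))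
      ≤ ENNReal.ofReal (ρ * Real.exp (b*L) * (1/(m-b)+1/b)) := by
  have hmb : 0 < m - b := by linarith
  rw [← lintegral_add_compl _ (measurableSet_Iio (a := -(L*ρ))), compl_Iio,
    setLIntegral_congr Ioi_ae_eq_Ici.symm, mul_add,
    ENNReal.ofReal_add (by positivity) (by positivity)]
  refine add_le_add ?_ ?_
  · have := aux_expL ((m-b)/ρ) (m*L) (-(L*ρ)) (by positivity)
    calc _ = _ := setLIntegral_congr_fun measurableSet_Iio (fun y (hy : y < _) => ?_)
      _ = _ := this
      _ ≤ _ := le_of_eq ?_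
    · simp only [omegaFn, if_pos hy.le]
      congr 2; field_simp; ring
    · have : (m-b)/ρ * -(L*ρ) + m*L = b*L := by field_simp; ring
      rw [this]; congr 1; field_simp
  · have := aux_expR (b/ρ) 0 (-(L*ρ)) (by positivity)
    calc _ ≤ _ := setLIntegral_mono' measurableSet_Ioi (fun y (hy : -(L*ρ) < y) => ?_)
      _ = _ := this
      _ ≤ _ := le_of_eq ?_
    · apply ENNReal.ofReal_le_ofReal
      apply Real.exp_le_exp.2
      linarith [aux_om_nonpos m L ρ (by linarith) hρ y]
    · have : -(b/ρ) * -(L*ρ) + 0 = b*L := by field_simp; ring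
      rw [this]; congr 1; field_simp

lemma aux_K1 {K : ℝ → ℝ → ℝ} {γ a K0 δ : ℝ} (hK : KernelHyp K γ a K0 δ) (x : ℝ) (hx : 0 < x)
    (hx2 : x < 2) : K x 1 ≤ (1+2*K0) * x ^ (-a) := by
  obtain ⟨h1, h2, -, -, -, -, hK0, ⟨hd0, hd1⟩, h⟩ := hK
  have hd : δ < 1 := lt_of_lt_of_le hd1 (min_le_left _ _)
  have h3 := (abs_le.1 (h x ⟨hx, hx2⟩)).2
  have h4 : x ^ δ ≤ 2 := by
    rcases le_total x 1 with h5 | h5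
    · linarith [Real.rpow_le_one hx.le h5 hd0.le]
    · have := Real.rpow_le_rpow_of_exponent_le h5 hd.le
      rw [Real.rpow_one] at this; linarith
  have h5 : x ^ a * K x 1 ≤ 1 + 2*K0 := by nlinarith
  have h6 : 0 < x ^ a := Real.rpow_pos_of_pos hx a
  rw [Real.rpow_neg hx.le, ← div_eq_mul_inv, le_div_iff₀ h6]
  linarith

lemma aux_K2 {K : ℝ → ℝ → ℝ} {γ a K0 δ : ℝ} (hK : KernelHyp K γ a K0 δ) (x : ℝ) (hx : 1 ≤ x) :
    K x 1 ≤ (1+2*K0) * x := by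
  have hx0 : 0 < x := by linarith
  have h1 := aux_K1 hK x⁻¹ (by positivity) (lt_of_le_of_lt (inv_le_one_of_one_le₀ hx) (by norm_num))
  obtain ⟨-, h2, -, -, hs, hh, hK0, -, -⟩ := hK
  have h3 := hh 1 x⁻¹ x one_pos (by positivity) hx0
  rw [mul_one, mul_inv_cancel₀ hx0.ne', hs 1 x⁻¹ one_pos (by positivity)] at h3
  rw [h3]
  have h4 : 0 < x ^ γ := Real.rpow_pos_of_pos hx0 _
  calc x ^ γ * K x⁻¹ 1 ≤ x ^ γ * ((1+2*K0) * x⁻¹ ^ (-a)) := by gcongr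
    _ = (1+2*K0) * (x ^ γ * x ^ a) := by
      rw [Real.inv_rpow hx0.le, Real.rpow_neg hx0.le, inv_inv]; ring
    _ = _ := by rw [← Real.rpow_add hx0, h2]; simp

lemma aux_G1 {K : ℝ → ℝ → ℝ} {γ a K0 δ : ℝ} (hK : KernelHyp K γ a K0 δ) (ρ y z : ℝ) (hρ : 0 < ρ)
    (h : Real.exp ((y-z)/ρ) < 2) :
    Real.exp (-(a/ρ)*z) * K (Real.exp ((y-z)/ρ)) 1 ≤ (1+2*K0) * Real.exp (-(a/ρ)*y) := by
  have h1 := aux_K1 hK _ (Real.exp_pos _) h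
  calc _ ≤ Real.exp (-(a/ρ)*z) * ((1+2*K0) * Real.exp ((y-z)/ρ) ^ (-a)) := by gcongr
    _ = (1+2*K0) * (Real.exp (-(a/ρ)*z) * Real.exp (((y-z)/ρ) * -a)) := by
      rw [← Real.exp_mul]; ring
    _ = _ := by rw [← Real.exp_add]; congr 2; field_simp; ring

lemma aux_G2 {K : ℝ → ℝ → ℝ} {γ a K0 δ : ℝ} (hK : KernelHyp K γ a K0 δ) (ρ y z : ℝ) (hρ : 0 < ρ)
    (h : z ≤ y) :
    Real.exp (-(a/ρ)*z) * K (Real.exp ((y-z)/ρ)) 1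
      ≤ (1+2*K0) * Real.exp (-(a/ρ)*z + (y-z)/ρ) := by
  have h1 := aux_K2 hK (Real.exp ((y-z)/ρ)) (Real.one_le_exp (div_nonneg (by linarith) hρ.le))
  calc _ ≤ Real.exp (-(a/ρ)*z) * ((1+2*K0) * Real.exp ((y-z)/ρ)) := by gcongr
    _ = _ := by rw [Real.exp_add]; ring

lemma aux_G {K : ℝ → ℝ → ℝ} {γ a K0 δ : ℝ} (hK : KernelHyp K γ a K0 δ) (ρ y z : ℝ) (hρ : 0 < ρ) :
    Real.exp (-(a/ρ)*z) * K (Real.exp ((y-z)/ρ)) 1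
      ≤ (1+2*K0) * Real.exp (-(a/ρ)*y) + (1+2*K0) * Real.exp (-(a/ρ)*z + (y-z)/ρ) := by
  have hK0 : 0 < K0 := hK.2.2.2.2.2.2.1
  rcases le_total z y with h | h
  · have := aux_G2 hK ρ y z hρ h
    have h2 : 0 ≤ (1+2*K0) * Real.exp (-(a/ρ)*y) := by positivity
    linarith
  · have := aux_G1 hK ρ y z hρ (lt_of_le_of_lt
      (Real.exp_le_one_iff.2 (div_nonpos_of_nonpos_of_nonneg (by linarith) hρ.le)) (by norm_num))
    have h2 : 0 ≤ (1+2*K0) * Real.exp (-(a/ρ)*z + (y-z)/ρ) := by positivity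
    linarith

lemma aux_G0 {K : ℝ → ℝ → ℝ} {γ a K0 δ : ℝ} (hK : KernelHyp K γ a K0 δ) (ρ y z : ℝ) :
    0 ≤ Real.exp (-(a/ρ)*z) * K (Real.exp ((y-z)/ρ)) 1 :=
  mul_nonneg (Real.exp_pos _).le (hK.2.2.2.1 _ _ (Real.exp_pos _) one_pos)

lemma aux_F {g h1 h2 G w1 w2 : ℝ} (hg : 0 ≤ g) (hG : g ≤ G) (e1 : |h1| ≤ 2 * w1)
    (e2 : |h2| ≤ 2 * w2) : |g * h1 * h2| ≤ 4 * G * (w1 * w2) := by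
  rw [abs_mul, abs_mul, abs_of_nonneg hg]
  have a1 := abs_nonneg h1
  have a2 := abs_nonneg h2
  have a3 : 0 ≤ G := hg.trans hG
  have a4 : 0 ≤ 2*w1 := a1.trans e1
  calc g * |h1| * |h2| ≤ G * (2*w1) * (2*w2) :=
        mul_le_mul (mul_le_mul hG e1 a1 a3) e2 a2 (mul_nonneg a3 a4)
    _ = _ := by ring

lemma aux_dblProdC {A B' : Set ℝ} {B : ℝ → Set ℝ} (hA : MeasurableSet A)
    (hB : ∀ y, MeasurableSet (B y)) (hBB : ∀ y ∈ A, B y ⊆ B')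
    (F : ℝ → ℝ → ℝ) (c : ℝ) (hc : 0 < c) (P1 Q1 P2 Q2 : ℝ → ℝ) (p1 q1 p2 q2 : ℝ)
    (mP1 : Measurable P1) (mQ1 : Measurable Q1) (mP2 : Measurable P2) (mQ2 : Measurable Q2)
    (nP1 : ∀ y, 0 ≤ P1 y) (nQ1 : ∀ y, 0 ≤ Q1 y) (nP2 : ∀ y, 0 ≤ P2 y) (nQ2 : ∀ y, 0 ≤ Q2 y)
    (np1 : 0 ≤ p1) (nq1 : 0 ≤ q1) (np2 : 0 ≤ p2) (nq2 : 0 ≤ q2)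
    (hp1 : ∫⁻ y in A, ENNReal.ofReal (P1 y) ≤ ENNReal.ofReal p1)
    (hq1 : ∫⁻ y in B', ENNReal.ofReal (Q1 y) ≤ ENNReal.ofReal q1)
    (hp2 : ∫⁻ y in A, ENNReal.ofReal (P2 y) ≤ ENNReal.ofReal p2)
    (hq2 : ∫⁻ y in B', ENNReal.ofReal (Q2 y) ≤ ENNReal.ofReal q2)
    (h : ∀ y ∈ A, ∀ z ∈ B y, |F y z| ≤ c * (P1 y * Q1 z + P2 y * Q2 z)) :
    |∫ y in A, ∫ z in B y, F y z| ≤ c * (p1*q1 + p2*q2) := by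
  have := aux_dblProd hA hB hBB (fun y z => c⁻¹ * F y z) P1 Q1 P2 Q2 p1 q1 p2 q2 mP1 mQ1 mP2 mQ2
    nP1 nQ1 nP2 nQ2 np1 nq1 np2 nq2 hp1 hq1 hp2 hq2 (fun y hy z hz => by
      rw [abs_mul, abs_of_pos (inv_pos.2 hc), inv_mul_le_iff₀ hc]
      exact h y hy z hz)
  simp_rw [integral_const_mul] at this
  rwa [abs_mul, abs_of_pos (inv_pos.2 hc), inv_mul_le_iff₀ hc] at this

lemma aux_w (ρ x y : ℝ) (hρ : 0 < ρ) (hy : y < x) :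
    x + ρ * Real.log (1 - Real.exp ((y-x)/ρ)) ≤ x := by
  have h1 : Real.exp ((y-x)/ρ) < 1 :=
    Real.exp_lt_one_iff.2 (div_neg_of_neg_of_pos (by linarith) hρ)
  have := Real.log_nonpos (x := 1 - Real.exp ((y-x)/ρ)) (by linarith)
    (by linarith [Real.exp_pos ((y-x)/ρ)])
  nlinarith

lemma aux_R1 {K : ℝ → ℝ → ℝ} {γ a K0 δ m L ρ : ℝ} (hK : KernelHyp K γ a K0 δ) (ha : 0 < a)
    (hm : a + 1 < m) (hL : 0 < L) (hρ : 0 < ρ) {h : ℝ → ℝ} (hh : memX a m L ρ h) (x : ℝ)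
    (hx : x ≤ -(L*ρ)) :
    |Rfun K a L ρ h x| ≤ (4*(1+2*K0)*(1/(m*(m-a)) + 1/((m+1)*(m-a-1)))) * ρ
      * Real.exp (-(a/ρ)*x) * Real.exp ((2*m/ρ)*(x+L*ρ)) := by
  have hK0 : 0 < K0 := hK.2.2.2.2.2.2.1
  have hLρ : 0 < L*ρ := by positivity
  have hm0 : 0 < m := by linarith
  have hma : 0 < m - a := by linarith
  have hma1 : 0 < m - a - 1 := by linarith
  have hb : ∀ y, y < x → |h y| ≤ 2 * Real.exp (m/ρ*(y+L*ρ)) := fun y hy => by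
    have := hh.2.2.2 y
    rwa [omegaFn, if_pos (by linarith)] at this
  have key := aux_dblProdC (A := Iio x) (B' := Iio x)
    (B := fun y => Iio (x + ρ * Real.log (1 - Real.exp ((y-x)/ρ)))) measurableSet_Iio
    (fun y => measurableSet_Iio) (fun y hy => Iio_subset_Iio (aux_w ρ x y hρ hy))
    (fun y z => Real.exp (-(a/ρ)*z) * K (Real.exp ((y-z)/ρ)) 1 * h y * h z)
    (4*(1+2*K0)) (by positivity)
    (fun y => Real.exp ((m-a)/ρ*y+m*L)) (fun z => Real.exp (m/ρ*z+m*L))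
    (fun y => Real.exp ((m+1)/ρ*y+m*L)) (fun z => Real.exp ((m-a-1)/ρ*z+m*L))
    _ _ _ _ (by fun_prop) (by fun_prop) (by fun_prop) (by fun_prop)
    (fun y => by positivity) (fun y => by positivity) (fun y => by positivity)
    (fun y => by positivity) (by positivity) (by positivity) (by positivity) (by positivity)
    (aux_expL ((m-a)/ρ) (m*L) x (by positivity)).le (aux_expL (m/ρ) (m*L) x (by positivity)).le
    (aux_expL ((m+1)/ρ) (m*L) x (by positivity)).le
    (aux_expL ((m-a-1)/ρ) (m*L) x (by positivity)).le
    (fun y hy z hz => by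
      have hz' : z < x := lt_of_lt_of_le hz (aux_w ρ x y hρ hy)
      refine (aux_F (aux_G0 hK ρ y z) (aux_G hK ρ y z hρ) (hb y hy) (hb z hz')).trans (le_of_eq ?_)
      have e1 : Real.exp (-(a/ρ)*y) * (Real.exp (m/ρ*(y+L*ρ)) * Real.exp (m/ρ*(z+L*ρ)))
        = Real.exp ((m-a)/ρ*y+m*L) * Real.exp (m/ρ*z+m*L) := by
        simp only [← Real.exp_add]; congr 1; field_simp; ring
      have e2 : Real.exp (-(a/ρ)*z + (y-z)/ρ) * (Real.exp (m/ρ*(y+L*ρ)) * Real.exp (m/ρ*(z+L*ρ)))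
        = Real.exp ((m+1)/ρ*y+m*L) * Real.exp ((m-a-1)/ρ*z+m*L) := by
        simp only [← Real.exp_add]; congr 1; field_simp; ring
      rw [← e1, ← e2]; ring)
  rw [Rfun, if_pos (by linarith), abs_mul, abs_neg, abs_of_pos (by positivity : 0 < 1/ρ)]
  refine (mul_le_mul_of_nonneg_left key (by positivity)).trans (le_of_eq ?_)
  have e1 : Real.exp ((m-a)/ρ*x+m*L) * Real.exp (m/ρ*x+m*L)
      = Real.exp (-(a/ρ)*x) * Real.exp ((2*m/ρ)*(x+L*ρ)) := by
    simp only [← Real.exp_add]; congr 1; field_simp; ring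
  have e2 : Real.exp ((m+1)/ρ*x+m*L) * Real.exp ((m-a-1)/ρ*x+m*L)
      = Real.exp (-(a/ρ)*x) * Real.exp ((2*m/ρ)*(x+L*ρ)) := by
    simp only [← Real.exp_add]; congr 1; field_simp; ring
  rw [div_mul_div_comm, e1, div_mul_div_comm (Real.exp ((m+1)/ρ*x+m*L)), e2]
  field_simp

lemma aux_R2 {K : ℝ → ℝ → ℝ} {γ a K0 δ m L ρ : ℝ} (hK : KernelHyp K γ a K0 δ) (ha : 0 < a)
    (hm : a + 1 < m) (hρ : 0 < ρ) {h : ℝ → ℝ} (hh : memX a m L ρ h) (x : ℝ)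
    (hx : x < L*ρ) :
    |Rfun K a L ρ h x| ≤ (4*(1+2*K0)*((1/(m-a)+1/a)*(1/(m-1)+1/1) + (1/(m-(a+1))+1/(a+1)))) * ρ
      * Real.exp ((a+2)*L) := by
  have hK0 : 0 < K0 := hK.2.2.2.2.2.2.1
  have hm0 : 0 < m := by linarith
  have hma : 0 < m - a := by linarith
  have hm1 : 0 < m - 1 := by linarith
  have hma1 : 0 < m - (a + 1) := by linarith
  have hom := aux_om_meas m L ρ
  have hb := hh.2.2.2
  have key := aux_dblProdC (A := Iio x) (B' := Iio x)
    (B := fun y => Iio (x + ρ * Real.log (1 - Real.exp ((y-x)/ρ)))) measurableSet_Iio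
    (fun y => measurableSet_Iio) (fun y hy => Iio_subset_Iio (aux_w ρ x y hρ hy))
    (fun y z => Real.exp (-(a/ρ)*z) * K (Real.exp ((y-z)/ρ)) 1 * h y * h z)
    (4*(1+2*K0)) (by positivity)
    (fun y => Real.exp (-(a/ρ)*y+omegaFn m L ρ y)) (fun z => Real.exp (omegaFn m L ρ z))
    (fun y => Real.exp (1/ρ*y+0)) (fun z => Real.exp (-((a+1)/ρ)*z+omegaFn m L ρ z))
    (ρ * Real.exp (a*L) * (1/(m-a)+1/a)) (Real.exp L * (ρ * Real.exp (1*L) * (1/(m-1)+1/1)))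
    (Real.exp (1/ρ*x+0)/(1/ρ)) (ρ * Real.exp ((a+1)*L) * (1/(m-(a+1))+1/(a+1)))
    (by fun_prop) (by fun_prop) (by fun_prop) (by fun_prop)
    (fun y => by positivity) (fun y => by positivity) (fun y => by positivity)
    (fun y => by positivity) (by positivity) (by positivity) (by positivity) (by positivity)
    ((setLIntegral_le_lintegral _ _).trans (aux_J m L ρ a ha (by linarith) hρ))
    (by
      rw [ENNReal.ofReal_mul (Real.exp_pos _).le]
      refine le_trans ?_ (mul_le_mul_right (aux_J m L ρ 1 one_pos (by linarith) hρ) _)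
      rw [← lintegral_const_mul _ (by fun_prop)]
      refine le_trans ?_ (setLIntegral_le_lintegral (Iio x) _)
      refine setLIntegral_mono' measurableSet_Iio fun z (hz : z < x) => ?_
      rw [← ENNReal.ofReal_mul (Real.exp_pos _).le, ← Real.exp_add]
      apply ENNReal.ofReal_le_ofReal
      apply Real.exp_le_exp.2
      have : z / ρ ≤ L := by rw [div_le_iff₀ hρ]; linarith
      have e : -(1/ρ)*z = -(z/ρ) := by ring
      rw [e]; linarith)
    (aux_expL (1/ρ) 0 x (by positivity)).le
    ((setLIntegral_le_lintegral _ _).trans (aux_J m L ρ (a+1) (by linarith) (by linarith) hρ))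
    (fun y hy z hz => by
      refine (aux_F (aux_G0 hK ρ y z) (aux_G hK ρ y z hρ) (hb y) (hb z)).trans ?_
      have e1 : Real.exp (-(a/ρ)*y) * (Real.exp (omegaFn m L ρ y) * Real.exp (omegaFn m L ρ z))
        = Real.exp (-(a/ρ)*y+omegaFn m L ρ y) * Real.exp (omegaFn m L ρ z) := by
        simp only [← Real.exp_add]; congr 1; ring
      have e2 : Real.exp (-(a/ρ)*z + (y-z)/ρ) *
          (Real.exp (omegaFn m L ρ y) * Real.exp (omegaFn m L ρ z))
        ≤ Real.exp (1/ρ*y+0) * Real.exp (-((a+1)/ρ)*z+omegaFn m L ρ z) := by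
        simp only [← Real.exp_add]
        apply Real.exp_le_exp.2
        have := aux_om_nonpos m L ρ hm0 hρ y
        have e : -(a/ρ)*z + (y-z)/ρ = 1/ρ*y + -((a+1)/ρ)*z := by ring
        linarith
      rw [← e1, mul_add, mul_assoc 4, add_mul, mul_add, ← mul_assoc] at *
      have : 0 < 4 * (1+2*K0) := by positivity
      nlinarith [mul_le_mul_of_nonneg_left e2 this.le])
  rw [Rfun, if_pos hx, abs_mul, abs_neg, abs_of_pos (by positivity : 0 < 1/ρ)]
  refine (mul_le_mul_of_nonneg_left key (by positivity)).trans ?_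
  have e0 : Real.exp (1/ρ*x+0) ≤ Real.exp L := by
    apply Real.exp_le_exp.2
    have : x / ρ ≤ L := by rw [div_le_iff₀ hρ]; linarith
    have e : 1/ρ*x = x/ρ := by ring
    linarith
  have e1 : Real.exp (a*L) * (Real.exp L * Real.exp (1*L)) = Real.exp ((a+2)*L) := by
    simp only [← Real.exp_add]; congr 1; ring
  have e2 : Real.exp L * Real.exp ((a+1)*L) = Real.exp ((a+2)*L) := by
    simp only [← Real.exp_add]; congr 1; ring
  set c1 := 1/(m-a)+1/a
  set c2 := 1/(m-1)+1/1
  have hc3 : 0 < 1/(m-(a+1))+1/(a+1) := by positivity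
  set c3 := 1/(m-(a+1))+1/(a+1)
  calc _ ≤ 1/ρ * (4*(1+2*K0) * (ρ * Real.exp (a*L) * c1 * (Real.exp L * (ρ * Real.exp (1*L) * c2))
        + Real.exp L / (1/ρ) * (ρ * Real.exp ((a+1)*L) * c3))) := by gcongr
    _ = 4*(1+2*K0) * ρ * (c1*c2*(Real.exp (a*L) * (Real.exp L * Real.exp (1*L)))
        + c3*(Real.exp L * Real.exp ((a+1)*L))) := by field_simp
    _ = _ := by rw [e1, e2]; ring

lemma aux_T1 {a m L ρ : ℝ} (ha : 0 < a) (hm : 0 < m) (hρ : 0 < ρ) (hL : 0 < L) {h : ℝ → ℝ}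
    (hh : memX a m L ρ h) (x : ℝ) (hx : L*ρ ≤ x) :
    |-(1/ρ) * (∫ y in Ioi x, Real.exp (-(a/ρ)*y) * h y) * (∫ z in Ioi x, h z)|
      ≤ (8/a) * Real.exp (-a*L) * Real.exp (-(1/2)*(x-L*ρ)) := by
  have hb := hh.2.2.2
  have i1 : |∫ y in Ioi x, Real.exp (-(a/ρ)*y) * h y| ≤ 2 * (Real.exp (-(a/ρ)*x+0)/(a/ρ)) := by
    apply aux_abs_le _ _ (by positivity)
    refine (enorm_integral_le_lintegral_enorm _).trans ?_
    rw [ENNReal.ofReal_mul (by norm_num), ← aux_expR (a/ρ) 0 x (by positivity),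
      ← lintegral_const_mul _ (by fun_prop)]
    refine setLIntegral_mono' measurableSet_Ioi fun y (hy : x < y) => ?_
    rw [← ENNReal.ofReal_mul (by norm_num), ← ofReal_norm]
    apply ENNReal.ofReal_le_ofReal
    rw [Real.norm_eq_abs, abs_mul, abs_of_pos (Real.exp_pos _), add_zero, mul_comm 2]
    have := Real.exp_le_one_iff.2 (aux_om_nonpos m L ρ hm hρ y)
    have := hb y
    gcongr; linarith
  have i2 : |∫ z in Ioi x, h z| ≤ 2 * (Real.exp (-(1/2)*x+(1/2)*(L*ρ))/(1/2)) := by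
    apply aux_abs_le _ _ (by positivity)
    refine (enorm_integral_le_lintegral_enorm _).trans ?_
    rw [ENNReal.ofReal_mul (by norm_num), ← aux_expR (1/2) ((1/2)*(L*ρ)) x (by positivity),
      ← lintegral_const_mul _ (by fun_prop)]
    refine setLIntegral_mono' measurableSet_Ioi fun y (hy : x < y) => ?_
    rw [← ENNReal.ofReal_mul (by norm_num), ← ofReal_norm]
    apply ENNReal.ofReal_le_ofReal
    refine (hb y).trans ?_
    gcongr
    linarith [aux_om_le m L ρ hm hρ hL y]
  rw [abs_mul, abs_mul, abs_neg, abs_of_pos (by positivity : 0 < 1/ρ)]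
  have e0 : Real.exp (-(a/ρ)*x+0) ≤ Real.exp (-a*L) := by
    apply Real.exp_le_exp.2
    have : L ≤ x / ρ := by rw [le_div_iff₀ hρ]; linarith
    have e : -(a/ρ)*x = -a*(x/ρ) := by ring
    rw [e]; nlinarith
  have e1 : -(1/2)*x+(1/2)*(L*ρ) = -(1/2)*(x-L*ρ) := by ring
  rw [e1] at i2
  calc _ ≤ 1/ρ * (2 * (Real.exp (-a*L)/(a/ρ))) * (2 * (Real.exp (-(1/2)*(x-L*ρ))/(1/2))) := by
        gcongr; exact i1.trans (by gcongr)
    _ = _ := by field_simp; ring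

lemma aux_T2 {K : ℝ → ℝ → ℝ} {γ a K0 δ m L ρ : ℝ} (hK : KernelHyp K γ a K0 δ) (ha : 0 < a)
    (hm : a + 1 < m) (hρ : 0 < ρ) (hL : 0 < L) {h : ℝ → ℝ} (hh : memX a m L ρ h) (x : ℝ)
    (hx : L*ρ ≤ x) :
    |(1/ρ) * (∫ y in Iio x, ∫ z in Ioi x,
        (Real.exp (-(a/ρ)*z) * K (Real.exp ((y-z)/ρ)) 1 - Real.exp (-(a/ρ)*y)) * h y * h z)|
      ≤ (4*K0*(1/(m-(a-δ))+1/(a-δ))/δ) * (ρ * Real.exp (a*L)) * Real.exp (-(1/2)*(x-L*ρ)) := by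
  obtain ⟨-, -, -, -, -, -, hK0, ⟨hd0, hd1⟩, hKe⟩ := hK
  have hda : 0 < a - δ := by linarith [lt_of_lt_of_le hd1 (min_le_right _ _)]
  have hm0 : 0 < m := by linarith
  have hmd : 0 < m - (a - δ) := by linarith
  have hom := aux_om_meas m L ρ
  have hb := hh.2.2.2
  have key := aux_dblProdC (A := Iio x) (B' := Ioi x)
    (B := fun y => Ioi x) measurableSet_Iio
    (fun y => measurableSet_Ioi) (fun y hy => subset_rfl)
    (fun y z => (Real.exp (-(a/ρ)*z) * K (Real.exp ((y-z)/ρ)) 1 - Real.exp (-(a/ρ)*y)) * h y * h z)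
    (4*K0) (by positivity)
    (fun y => Real.exp (-((a-δ)/ρ)*y+omegaFn m L ρ y))
    (fun z => Real.exp (-(δ/ρ)*z+ -(1/2)*(x-L*ρ)))
    (fun y => 0) (fun z => 0)
    (ρ * Real.exp ((a-δ)*L) * (1/(m-(a-δ))+1/(a-δ)))
    (Real.exp (-(δ/ρ)*x+ -(1/2)*(x-L*ρ))/(δ/ρ)) 0 0
    (by fun_prop) (by fun_prop) (by fun_prop) (by fun_prop)
    (fun y => by positivity) (fun y => by positivity) (fun y => le_rfl)
    (fun y => le_rfl) (by positivity) (by positivity) (by positivity) (by positivity)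
    ((setLIntegral_le_lintegral _ _).trans (aux_J m L ρ (a-δ) hda (by linarith) hρ))
    (aux_expR (δ/ρ) _ x (by positivity)).le
    (by simp) (by simp)
    (fun y hy z hz => by
      have hy : y < x := hy
      have hz : x < z := hz
      have h1 : Real.exp ((y-z)/ρ) < 1 :=
        Real.exp_lt_one_iff.2 (div_neg_of_neg_of_pos (by linarith) hρ)
      have h2 := hKe _ ⟨Real.exp_pos _, h1.trans one_lt_two⟩
      rw [← Real.exp_mul, ← Real.exp_mul] at h2
      have e1 : Real.exp (-(a/ρ)*z) * K (Real.exp ((y-z)/ρ)) 1 - Real.exp (-(a/ρ)*y)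
          = Real.exp (-(a/ρ)*y) * (Real.exp ((y-z)/ρ*a) * K (Real.exp ((y-z)/ρ)) 1 - 1) := by
        rw [mul_sub, ← mul_assoc, ← Real.exp_add, mul_one]
        congr 3; field_simp; ring
      have h3 : |Real.exp (-(a/ρ)*z) * K (Real.exp ((y-z)/ρ)) 1 - Real.exp (-(a/ρ)*y)|
          ≤ K0 * Real.exp (-((a-δ)/ρ)*y + -(δ/ρ)*z) := by
        rw [e1, abs_mul, abs_of_pos (Real.exp_pos _)]
        refine (mul_le_mul_of_nonneg_left h2 (Real.exp_pos _).le).trans (le_of_eq ?_)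
        rw [mul_left_comm, ← Real.exp_add]; congr 2; field_simp; ring
      have h4 := aux_F (abs_nonneg _) h3 (hb y) (hb z)
      rw [abs_mul, abs_mul, abs_abs, ← abs_mul, ← abs_mul] at h4
      refine h4.trans ?_
      have : Real.exp (-((a-δ)/ρ)*y + -(δ/ρ)*z) *
          (Real.exp (omegaFn m L ρ y) * Real.exp (omegaFn m L ρ z)) ≤
          Real.exp (-((a-δ)/ρ)*y+omegaFn m L ρ y) * Real.exp (-(δ/ρ)*z+ -(1/2)*(x-L*ρ)) := by
        simp only [← Real.exp_add]
        apply Real.exp_le_exp.2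
        linarith [aux_om_le m L ρ hm0 hρ hL z]
      have h5 := mul_le_mul_of_nonneg_left this (by positivity : 0 ≤ 4*K0)
      linarith)
  rw [abs_mul, abs_of_pos (by positivity : 0 < 1/ρ)]
  refine (mul_le_mul_of_nonneg_left key (by positivity)).trans ?_
  have e0 : Real.exp ((a-δ)*L) * Real.exp (-(δ/ρ)*x+ -(1/2)*(x-L*ρ))
      ≤ Real.exp (a*L) * Real.exp (-(1/2)*(x-L*ρ)) := by
    simp only [← Real.exp_add]
    apply Real.exp_le_exp.2
    have : L ≤ x / ρ := by rw [le_div_iff₀ hρ]; linarith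
    have e : -(δ/ρ)*x = -δ*(x/ρ) := by ring
    rw [e]; nlinarith [mul_pos hd0 hL]
  set c1 := 1/(m-(a-δ))+1/(a-δ)
  have hc1 : 0 < c1 := by positivity
  calc _ = 4*K0*c1/δ * ρ * (Real.exp ((a-δ)*L) * Real.exp (-(δ/ρ)*x+ -(1/2)*(x-L*ρ))) := by
        field_simp; ring
    _ ≤ 4*K0*c1/δ * ρ * (Real.exp (a*L) * Real.exp (-(1/2)*(x-L*ρ))) := by gcongr
    _ = _ := by ring

lemma aux_T3 {K : ℝ → ℝ → ℝ} {γ a K0 δ m L ρ : ℝ} (hK : KernelHyp K γ a K0 δ) (ha : 0 < a)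
    (hm : a + 1 < m) (hρ : 0 < ρ) (hρ1 : ρ < 1) (hL : 0 < L) {h : ℝ → ℝ} (hh : memX a m L ρ h)
    (x : ℝ) :
    |(1/ρ) * (∫ y in Iio x, ∫ z in Ioo (x + ρ * Real.log (1 - Real.exp ((y-x)/ρ))) x,
        Real.exp (-(a/ρ)*z) * K (Real.exp ((y-z)/ρ)) 1 * h y * h z)|
      ≤ (24*(1+2*K0)*(1/(m-a)+1/a)) * (ρ * Real.exp (a*L)) * Real.exp (-(1/2)*(x-L*ρ)) := by
  have hK0 : 0 < K0 := hK.2.2.2.2.2.2.1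
  have hm0 : 0 < m := by linarith
  have hma : 0 < m - a := by linarith
  have hom := aux_om_meas m L ρ
  have hb := hh.2.2.2
  have hl0 : 0 < Real.log 2 := Real.log_pos (by norm_num)
  have hl1 : Real.log 2 < 1 := by linarith [Real.log_two_lt_d9]
  set E := Real.exp (-(1/2)*(x-L*ρ)) with hE
  have hE0 : 0 < E := Real.exp_pos _
  have hnear : ∀ z, x - ρ * Real.log 2 < z → |h z| ≤ 2 * (2*E) := fun z hz => by
    refine (hb z).trans ?_
    have h1 := aux_om_le m L ρ hm0 hρ hL z
    have h2 : Real.exp (omegaFn m L ρ z) ≤ Real.exp (Real.log 2 + -(1/2)*(x-L*ρ)) := by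
      apply Real.exp_le_exp.2; nlinarith
    rw [Real.exp_add, Real.exp_log (by norm_num)] at h2
    linarith
  set P : ℝ → ENNReal := fun y => ENNReal.ofReal (Real.exp (-(a/ρ)*y+omegaFn m L ρ y)) with hPdef
  have mP : Measurable P := by fun_prop
  set q : ℝ → ENNReal := fun z =>
    ENNReal.ofReal (Real.exp (-(a/ρ)*z+(x-z)/ρ+omegaFn m L ρ z)) with hqdef
  have mq : Measurable q := by fun_prop
  set S : Set (ℝ × ℝ) := {p | x - 2*ρ*Real.exp ((p.2-x)/ρ) < p.1 ∧ p.1 < x} with hS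
  have mS : MeasurableSet S := by
    have s1 : MeasurableSet {p : ℝ × ℝ | x - 2*ρ*Real.exp ((p.2-x)/ρ) < p.1} :=
      measurableSet_lt (by fun_prop) (by fun_prop)
    have s2 : MeasurableSet {p : ℝ × ℝ | p.1 < x} := measurableSet_lt (by fun_prop) (by fun_prop)
    exact s1.inter s2
  set g1 : ℝ → ℝ → ENNReal := fun y z => P y * (Ioo (x - ρ * Real.log 2) x).indicator 1 z with hg1
  set g2 : ℝ → ℝ → ENNReal := fun y z => q z * S.indicator 1 (y,z) with hg2
  have m2 : Measurable (Function.uncurry g2) := by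
    have : Function.uncurry g2 = fun p : ℝ × ℝ => q p.2 * S.indicator 1 p := rfl
    rw [this]
    exact (mq.comp measurable_snd).mul (measurable_one.indicator mS)
  have i1 : ∫⁻ y, ∫⁻ z, g1 y z ≤ ENNReal.ofReal (ρ * Real.exp (a*L) * (1/(m-a)+1/a) * ρ) := by
    have e : ∀ y, ∫⁻ z, g1 y z = P y * ENNReal.ofReal (ρ * Real.log 2) := fun y => by
      rw [hg1]
      simp only
      rw [lintegral_const_mul _ (measurable_one.indicator measurableSet_Ioo),
        lintegral_indicator_one measurableSet_Ioo, Real.volume_Ioo]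
      congr 2; ring
    simp_rw [e]
    rw [lintegral_mul_const _ mP,
      ENNReal.ofReal_mul (p := ρ * Real.exp (a*L) * (1/(m-a)+1/a)) (by positivity)]
    refine mul_le_mul' (aux_J m L ρ a ha (by linarith) hρ) (ENNReal.ofReal_le_ofReal ?_)
    nlinarith
  have i2 : ∫⁻ y, ∫⁻ z, g2 y z ≤ ENNReal.ofReal (2*ρ*(ρ * Real.exp (a*L) * (1/(m-a)+1/a))) := by
    rw [lintegral_lintegral_swap m2.aemeasurable]
    have e : ∀ z, ∫⁻ y, g2 y z = ENNReal.ofReal (2*ρ) * P z := fun z => by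
      have e1 : ∀ y, g2 y z =
          q z * (Ioo (x - 2*ρ*Real.exp ((z-x)/ρ)) x).indicator 1 y := fun y => rfl
      simp_rw [e1]
      rw [lintegral_const_mul _ (measurable_one.indicator measurableSet_Ioo),
        lintegral_indicator_one measurableSet_Ioo, Real.volume_Ioo, hqdef, hPdef]
      simp only
      rw [← ENNReal.ofReal_mul (Real.exp_pos _).le, ← ENNReal.ofReal_mul (by positivity)]
      congr 1
      have : -(a/ρ)*z+omegaFn m L ρ z = (-(a/ρ)*z+(x-z)/ρ+omegaFn m L ρ z) + (z-x)/ρ := by ring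
      rw [this, Real.exp_add _ ((z-x)/ρ)]; ring
    simp_rw [e]
    rw [lintegral_const_mul _ mP, ENNReal.ofReal_mul (p := 2*ρ)
      (q := ρ * Real.exp (a*L) * (1/(m-a)+1/a)) (by positivity)]
    exact mul_le_mul' le_rfl (aux_J m L ρ a ha (by linarith) hρ)
  have key : |∫ y in Iio x, ∫ z in Ioo (x + ρ * Real.log (1 - Real.exp ((y-x)/ρ))) x,
        Real.exp (-(a/ρ)*z) * K (Real.exp ((y-z)/ρ)) 1 * h y * h z|
      ≤ 8*(1+2*K0)*E * (ρ * Real.exp (a*L) * (1/(m-a)+1/a) * ρ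
        + 2*ρ*(ρ * Real.exp (a*L) * (1/(m-a)+1/a))) := by
    apply aux_abs_le _ _ (by positivity)
    refine (aux_dblE measurableSet_Iio (fun y => measurableSet_Ioo) _
      (fun y z => ENNReal.ofReal (8*(1+2*K0)*E) * (g1 y z + g2 y z)) ?_).trans ?_
    · intro y hy z hz
      have hy : y < x := hy
      obtain ⟨hz1, hz2⟩ := hz
      rw [← ofReal_norm, Real.norm_eq_abs]
      have hs1 : Real.exp ((y-x)/ρ) < 1 :=
        Real.exp_lt_one_iff.2 (div_neg_of_neg_of_pos (by linarith) hρ)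
      have hdom : 1 - Real.exp ((y-x)/ρ) < Real.exp ((z-x)/ρ) := by
        rw [← Real.log_lt_iff_lt_exp (by linarith), lt_div_iff₀ hρ]
        linarith
      by_cases hc : x - ρ * Real.log 2 < z
      · have hyz : Real.exp ((y-z)/ρ) < 2 := by
          rw [← Real.lt_log_iff_exp_lt (by norm_num), div_lt_iff₀ hρ]
          linarith
        have h1 := aux_F (aux_G0 hK ρ y z) (aux_G1 hK ρ y z hρ hyz) (hb y) (hnear z hc)
        calc _ ≤ ENNReal.ofReal (8*(1+2*K0)*E) * g1 y z := by
              rw [hg1]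
              simp only
              rw [indicator_of_mem (show z ∈ Ioo _ _ from ⟨hc, hz2⟩), Pi.one_apply, mul_one,
                hPdef, ← ENNReal.ofReal_mul (by positivity)]
              apply ENNReal.ofReal_le_ofReal
              refine h1.trans (le_of_eq ?_)
              rw [Real.exp_add]; ring
          _ ≤ _ := by gcongr; exact le_self_add
      · push Not at hc
        have hs2 : Real.exp ((z-x)/ρ) ≤ 1/2 := by
          have : (1/2 : ℝ) = Real.exp (-Real.log 2) := by
            rw [Real.exp_neg, Real.exp_log (by norm_num)]; norm_num
          rw [this]
          apply Real.exp_le_exp.2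
          rw [div_le_iff₀ hρ]; linarith
        have hy2 : x - ρ * Real.log 2 < y := by
          have : (1/2 : ℝ) = Real.exp (-Real.log 2) := by
            rw [Real.exp_neg, Real.exp_log (by norm_num)]; norm_num
          have h3 : Real.exp (-Real.log 2) < Real.exp ((y-x)/ρ) := by linarith
          rw [Real.exp_lt_exp, lt_div_iff₀ hρ] at h3
          linarith
        have hmem : (y,z) ∈ S := by
          refine ⟨?_, hy⟩
          change x - 2*ρ*Real.exp ((z-x)/ρ) < y
          by_contra hcon
          push Not at hcon
          set s := Real.exp ((z-x)/ρ) with hs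
          have hs0 : 0 < s := Real.exp_pos _
          have h4 : (y-x)/ρ ≤ -(2*s) := by rw [div_le_iff₀ hρ]; linarith
          have h5 := Real.exp_le_exp.2 h4
          have h6 := Real.add_one_le_exp (2*s)
          have h7 : Real.exp (-(2*s)) * Real.exp (2*s) = 1 := by
            rw [← Real.exp_add]; simp
          have h8 : 1 - s < Real.exp (-(2*s)) := by linarith
          have h9 : (1-s)*(2*s+1) < 1 := by
            refine lt_of_lt_of_eq ?_ h7
            exact mul_lt_mul'' h8 (Real.add_one_lt_exp (x := 2*s) (by positivity))
              (by linarith) (by linarith)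
          nlinarith
        have h1 := aux_F (aux_G0 hK ρ y z) (aux_G2 hK ρ y z hρ (by linarith)) (hnear y hy2) (hb z)
        calc _ ≤ ENNReal.ofReal (8*(1+2*K0)*E) * g2 y z := by
              rw [hg2]
              simp only
              rw [indicator_of_mem hmem, Pi.one_apply, mul_one,
                hqdef, ← ENNReal.ofReal_mul (by positivity)]
              apply ENNReal.ofReal_le_ofReal
              refine h1.trans ?_
              have h2 : Real.exp (-(a/ρ)*z+(y-z)/ρ) ≤ Real.exp (-(a/ρ)*z+(x-z)/ρ) := by
                gcongr
              rw [Real.exp_add (-(a/ρ)*z+(x-z)/ρ)]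
              calc _ = 8*(1+2*K0)*E * (Real.exp (-(a/ρ)*z+(y-z)/ρ)
                      * Real.exp (omegaFn m L ρ z)) := by ring
                _ ≤ _ := by gcongr
          _ ≤ _ := by gcongr; exact le_add_self
    · calc _ ≤ ∫⁻ y, ∫⁻ z, ENNReal.ofReal (8*(1+2*K0)*E) * (g1 y z + g2 y z) :=
            (setLIntegral_le_lintegral _ _).trans
              (lintegral_mono fun y => setLIntegral_le_lintegral _ _)
        _ = ENNReal.ofReal (8*(1+2*K0)*E) * ((∫⁻ y, ∫⁻ z, g1 y z) + ∫⁻ y, ∫⁻ z, g2 y z) := by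
            have m3 : Measurable (fun y => ∫⁻ z, g2 y z) := m2.lintegral_prod_right'
            rw [← lintegral_add_right _ m3,
              ← lintegral_const_mul' _ _ ENNReal.ofReal_ne_top]
            refine lintegral_congr fun y => ?_
            rw [lintegral_const_mul' _ _ ENNReal.ofReal_ne_top, lintegral_add_right]
            exact m2.comp measurable_prodMk_left
        _ ≤ _ := by
            rw [ENNReal.ofReal_mul (p := 8*(1+2*K0)*E) (q := _ + _) (by positivity),
              ENNReal.ofReal_add (by positivity) (by positivity)]
            exact mul_le_mul' le_rfl (add_le_add i1 i2)
  rw [abs_mul, abs_of_pos (by positivity : 0 < 1/ρ)]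
  refine (mul_le_mul_of_nonneg_left key (by positivity)).trans (le_of_eq ?_)
  generalize 1/(m-a)+1/a = c
  field_simp
  ring

/-- bounds on the remainder R[h] (estimate (4.10) of the paper). -/
theorem R_bounds
    (γ a K0 δ m L0 ρ0 : ℝ) (hγ : γ < 1) (ha : a = 1 - γ)
    (hK0 : 0 < K0) (hδ : δ ∈ Ioo 0 (min 1 a)) (hP : ParamHyp a m L0 ρ0) :
    ∃ C : ℝ, 0 < C ∧
      ∀ K : ℝ → ℝ → ℝ, KernelHyp K γ a K0 δ →
      ∀ L : ℝ, L0 ≤ L → ∀ ρ ∈ Ioo (0:ℝ) ρ0,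
      ∀ h : ℝ → ℝ, memX a m L ρ h →
        (∀ x : ℝ, x ≤ -(L*ρ) →
          |Rfun K a L ρ h x| ≤ C * ρ * Real.exp (-(a/ρ)*x) * Real.exp ((2*m/ρ)*(x+L*ρ))) ∧
        (∀ x : ℝ, -(L*ρ) < x → x < L*ρ →
          |Rfun K a L ρ h x| ≤ C * ρ * Real.exp ((a+2)*L)) ∧
        (∀ x : ℝ, L*ρ ≤ x →
          |Rfun K a L ρ h x|
            ≤ C * (Real.exp (-a*L) + ρ * Real.exp (a*L)) * Real.exp (-(1/2)*(x-L*ρ))) := by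
  have ha0 : 0 < a := by linarith
  obtain ⟨hm, hL0, hρ0, hρ1⟩ := hP
  obtain ⟨hd0, hd1⟩ := hδ
  have hm1 : a + 1 < m := lt_of_le_of_lt (le_max_left _ _) hm
  have hda : 0 < a - δ := by linarith [lt_of_lt_of_le hd1 (min_le_right _ _)]
  have hL0' : 0 < L0 := by
    refine lt_trans ?_ hL0
    have : 0 < Real.log (4*m) := Real.log_pos (by linarith)
    positivity
  have hm0 : 0 < m := by linarith
  have q1 : 0 < m - a := by linarith
  have q2 : 0 < m - a - 1 := by linarith
  have q3 : 0 < m - 1 := by linarith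
  have q4 : 0 < m - (a+1) := by linarith
  have q5 : 0 < m - (a-δ) := by linarith
  obtain ⟨C1, hC1⟩ : ∃ c, c = 4*(1+2*K0)*(1/(m*(m-a)) + 1/((m+1)*(m-a-1))) := ⟨_, rfl⟩
  obtain ⟨C2, hC2⟩ : ∃ c, c =
    4*(1+2*K0)*((1/(m-a)+1/a)*(1/(m-1)+1/1) + (1/(m-(a+1))+1/(a+1))) := ⟨_, rfl⟩
  obtain ⟨D1, hD1⟩ : ∃ c, c = 8/a := ⟨_, rfl⟩
  obtain ⟨D2, hD2⟩ : ∃ c, c = 4*K0*(1/(m-(a-δ))+1/(a-δ))/δ := ⟨_, rfl⟩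
  obtain ⟨D3, hD3⟩ : ∃ c, c = 24*(1+2*K0)*(1/(m-a)+1/a) := ⟨_, rfl⟩
  have pC1 : 0 < C1 := by rw [hC1]; positivity
  have pC2 : 0 < C2 := by rw [hC2]; positivity
  have pD1 : 0 < D1 := by rw [hD1]; positivity
  have pD2 : 0 < D2 := by rw [hD2]; positivity
  have pD3 : 0 < D3 := by rw [hD3]; positivity
  refine ⟨C1 + C2 + D1 + D2 + D3, by positivity, ?_⟩
  intro K hK L hL ρ hρ h hh
  obtain ⟨hρp, hρlt⟩ := hρ
  have hLp : 0 < L := by linarith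
  have hLρ : 0 < L*ρ := by positivity
  refine ⟨fun x hx => ?_, fun x _ hx => ?_, fun x hx => ?_⟩
  · refine (aux_R1 hK ha0 hm1 hLp hρp hh x hx).trans ?_
    rw [← hC1]
    gcongr
    linarith
  · refine (aux_R2 hK ha0 hm1 hρp hh x hx).trans ?_
    rw [← hC2]
    gcongr
    linarith
  · have t1 := aux_T1 ha0 hm0 hρp hLp hh x hx
    have t2 := aux_T2 hK ha0 hm1 hρp hLp hh x hx
    have t3 := aux_T3 hK ha0 hm1 hρp (by linarith) hLp hh x
    rw [← hD1] at t1
    rw [← hD2] at t2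
    rw [← hD3] at t3
    rw [Rfun, if_neg (not_lt.2 hx)]
    refine (abs_add_le _ _).trans ((add_le_add ((abs_add_le _ _).trans (add_le_add t1 t2)) t3).trans ?_)
    have u : 0 < Real.exp (-a*L) := Real.exp_pos _
    have v : 0 < ρ * Real.exp (a*L) := by positivity
    rw [← add_mul, ← add_mul]
    gcongr
    nlinarith [mul_pos pC1 u, mul_pos pC1 v, mul_pos pC2 u, mul_pos pC2 v, mul_pos pD1 v,
      mul_pos pD2 u, mul_pos pD3 u]
end
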